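/- If the ground-truth matrix Ā is a global minimizer over A ∈ ℝ^{n×m} of the loss g(A) = Σ_{t=0}^{T−1} ‖(Ā − A) f(x_t) + d̄_t‖₂, then ‖Σ_{t∈K} f(x_t) d̂_tᵀ‖_F ≤ Σ_{t∈K^c} ‖f(x_t)‖₂, where ‖·‖_F is the Frobenius norm. -/

import Mathlib

open Matrix
open scoped BigOperators Classical

/-- Euclidean norm of a vector in `ℝ^k`. -/
noncomputable def e2norm {k : ℕ} (v : Fin k → ℝ) : ℝ := Real.sqrt (∑ i, (v i) ^ 2)

/-- Frobenius norm of a real matrix. -/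
noncomputable def frob {a b : ℕ} (M : Matrix (Fin a) (Fin b) ℝ) : ℝ :=
  Real.sqrt (∑ i, ∑ j, (M i j) ^ 2)

/-- Normalized attack direction `d̂ = d / ‖d‖₂`. -/
noncomputable def dhat {k : ℕ} (v : Fin k → ℝ) : Fin k → ℝ := (e2norm v)⁻¹ • v

theorem e2_nonneg {k : ℕ} (v : Fin k → ℝ) : 0 ≤ e2norm v := Real.sqrt_nonneg _

theorem e2_sq {k : ℕ} (v : Fin k → ℝ) : e2norm v ^ 2 = ∑ i, (v i) ^ 2 :=
  Real.sq_sqrt (Finset.sum_nonneg fun _ _ => sq_nonneg _)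

theorem e2_pos {k : ℕ} (v : Fin k → ℝ) (hv : v ≠ 0) : 0 < e2norm v := by
  refine lt_of_le_of_ne (e2_nonneg v) fun h => hv ?_
  have h2 := e2_sq v
  rw [← h] at h2
  have h3 := (Finset.sum_eq_zero_iff_of_nonneg (fun i _ => sq_nonneg (v i))).1
    (by linarith : ∑ i, (v i) ^ 2 = 0)
  funext i
  exact pow_eq_zero_iff (two_ne_zero) |>.1 (h3 i (Finset.mem_univ i))

theorem e2_perturb {k : ℕ} (d w : Fin k → ℝ) (hd : d ≠ 0) (ε : ℝ) :
    e2norm (-(ε • w) + d) ≤ e2norm d - ε * (dhat d ⬝ᵥ w)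
      + ε ^ 2 * (e2norm w ^ 2 / (2 * e2norm d)) := by
  have hN := e2_pos d hd
  have hX : e2norm (-(ε • w) + d) ^ 2
      = e2norm d ^ 2 - 2 * ε * (d ⬝ᵥ w) + ε ^ 2 * e2norm w ^ 2 := by
    rw [e2_sq, e2_sq, e2_sq, dotProduct, Finset.mul_sum, Finset.mul_sum,
      ← Finset.sum_sub_distrib, ← Finset.sum_add_distrib]
    refine Finset.sum_congr rfl fun i _ => ?_
    simp only [Pi.add_apply, Pi.neg_apply, Pi.smul_apply, smul_eq_mul]
    ring
  have hdw : dhat d ⬝ᵥ w = (e2norm d)⁻¹ * (d ⬝ᵥ w) := by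
    simp [dhat, smul_dotProduct]
  have h1 : e2norm (-(ε • w) + d) ≤
      (e2norm (-(ε • w) + d) ^ 2 + e2norm d ^ 2) / (2 * e2norm d) := by
    rw [le_div_iff₀ (by positivity)]
    nlinarith [sq_nonneg (e2norm (-(ε • w) + d) - e2norm d)]
  refine h1.trans (le_of_eq ?_)
  rw [hX, hdw]
  field_simp
  ring

theorem frob_sq {a b : ℕ} (M : Matrix (Fin a) (Fin b) ℝ) :
    frob M ^ 2 = ∑ i, ∑ j, (M i j) ^ 2 :=
  Real.sq_sqrt (Finset.sum_nonneg fun _ _ => Finset.sum_nonneg fun _ _ => sq_nonneg _)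

theorem e2_mulVec {a b : ℕ} (M : Matrix (Fin a) (Fin b) ℝ) (v : Fin a → ℝ) :
    e2norm (Mᵀ *ᵥ v) ≤ frob M * e2norm v := by
  have hF : 0 ≤ frob M := Real.sqrt_nonneg _
  refine abs_le_of_sq_le_sq' ?_ (mul_nonneg hF (e2_nonneg v)) |>.2
  rw [mul_pow, e2_sq, e2_sq, frob_sq, Finset.sum_comm, Finset.sum_mul]
  refine Finset.sum_le_sum fun j _ => ?_
  exact Finset.sum_mul_sq_le_sq_mul_sq Finset.univ (fun i => M i j) v

theorem e2_smul_neg {k : ℕ} (w : Fin k → ℝ) (ε : ℝ) (hε : 0 ≤ ε) :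
    e2norm (-(ε • w)) = ε * e2norm w := by
  have : ∑ i, ((-(ε • w)) i) ^ 2 = ε ^ 2 * ∑ i, (w i) ^ 2 := by
    rw [Finset.mul_sum]
    refine Finset.sum_congr rfl fun i _ => ?_
    simp only [Pi.neg_apply, Pi.smul_apply, smul_eq_mul]
    ring
  rw [e2norm, this, Real.sqrt_mul (sq_nonneg _), Real.sqrt_sq hε, e2norm]

/-- Corollary 2.3, necessary condition for optimality.
If `Ā` is a global minimizer of `g(A) = Σ_{t<T} ‖(Ā − A) f(x_t) + d̄_t‖₂`, then
`‖Σ_{t∈K} f(x_t) d̂_tᵀ‖_F ≤ Σ_{t∈K^c} ‖f(x_t)‖₂`. -/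
theorem necessary_condition_for_optimality
    (T n m : ℕ) (hT : 0 < T) (hn : 0 < n) (hm : 0 < m)
    (f : (Fin n → ℝ) → (Fin m → ℝ))
    (Abar : Matrix (Fin n) (Fin m) ℝ)
    (d : ℕ → (Fin n → ℝ)) (x : ℕ → (Fin n → ℝ))
    (hx0 : x 0 = 0)
    (hxstep : ∀ t < T, x (t + 1) = Abar.mulVec (f (x t)) + d t)
    (hopt : ∀ A : Matrix (Fin n) (Fin m) ℝ,
        ∑ t ∈ Finset.range T, e2norm ((Abar - Abar).mulVec (f (x t)) + d t) ≤
          ∑ t ∈ Finset.range T, e2norm ((Abar - A).mulVec (f (x t)) + d t)) :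
    frob (∑ t ∈ (Finset.range T).filter (fun t => d t ≠ 0),
        Matrix.vecMulVec (f (x t)) (dhat (d t))) ≤
      ∑ t ∈ (Finset.range T).filter (fun t => d t = 0), e2norm (f (x t)) := by
  set K := (Finset.range T).filter (fun t => d t ≠ 0) with hK
  set L := (Finset.range T).filter (fun t => d t = 0) with hL
  set M := ∑ t ∈ K, Matrix.vecMulVec (f (x t)) (dhat (d t)) with hM
  set S := ∑ t ∈ L, e2norm (f (x t)) with hS
  have hS0 : 0 ≤ S := Finset.sum_nonneg fun _ _ => e2_nonneg _
  have hF0 : 0 ≤ frob M := Real.sqrt_nonneg _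
  have split : ∀ h : ℕ → ℝ, ∑ t ∈ Finset.range T, h t = ∑ t ∈ L, h t + ∑ t ∈ K, h t :=
    fun h => (Finset.sum_filter_add_sum_filter_not _ (fun t => d t = 0) h).symm
  have hFro : ∑ t ∈ K, dhat (d t) ⬝ᵥ (Mᵀ *ᵥ f (x t)) = frob M ^ 2 := by
    have e : ∀ i j, M i j = ∑ t ∈ K, f (x t) i * dhat (d t) j := by
      intro i j
      rw [hM, Matrix.sum_apply]
      rfl
    have e2 : ∀ i j, M i j ^ 2 = ∑ t ∈ K, dhat (d t) j * (M i j * f (x t) i) := by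
      intro i j
      rw [pow_two]
      nth_rewrite 2 [e i j]
      rw [Finset.mul_sum]
      exact Finset.sum_congr rfl fun t _ => by ring
    rw [frob_sq, Finset.sum_comm]
    simp only [e2, dotProduct, mulVec, Matrix.transpose_apply, Finset.mul_sum]
    rw [Finset.sum_comm]
    refine Finset.sum_congr rfl fun j _ => ?_
    rw [Finset.sum_comm]
  set C := ∑ t ∈ K, e2norm (Mᵀ *ᵥ f (x t)) ^ 2 / (2 * e2norm (d t)) with hC
  have key : ∀ ε : ℝ, 0 < ε → frob M ^ 2 ≤ frob M * S + ε * C := by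
    intro ε hε
    have h := hopt (Abar + ε • Mᵀ)
    have hA : ∀ t, (Abar - (Abar + ε • Mᵀ)) *ᵥ f (x t) + d t
        = -(ε • (Mᵀ *ᵥ f (x t))) + d t := by
      intro t
      rw [sub_add_cancel_left, Matrix.neg_mulVec, Matrix.smul_mulVec]
    simp only [hA, sub_self, Matrix.zero_mulVec, zero_add] at h
    rw [split, split] at h
    have hz : ∑ t ∈ L, e2norm (d t) = 0 := by
      refine Finset.sum_eq_zero fun t ht => ?_
      rw [(Finset.mem_filter.1 ht).2]
      simp [e2norm]
    have h1 : ∑ t ∈ L, e2norm (-(ε • (Mᵀ *ᵥ f (x t))) + d t) ≤ ε * (frob M * S) := by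
      rw [hS, Finset.mul_sum, Finset.mul_sum]
      refine Finset.sum_le_sum fun t ht => ?_
      rw [(Finset.mem_filter.1 ht).2, add_zero, e2_smul_neg _ _ hε.le]
      exact mul_le_mul_of_nonneg_left (e2_mulVec _ _) hε.le
    have h2 : ∑ t ∈ K, e2norm (-(ε • (Mᵀ *ᵥ f (x t))) + d t) ≤
        ∑ t ∈ K, e2norm (d t) - ε * frob M ^ 2 + ε ^ 2 * C := by
      rw [← hFro, hC, Finset.mul_sum, Finset.mul_sum, ← Finset.sum_sub_distrib,
        ← Finset.sum_add_distrib]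
      exact Finset.sum_le_sum fun t ht => e2_perturb _ _ (Finset.mem_filter.1 ht).2 ε
    have h3 : ε * frob M ^ 2 ≤ ε * (frob M * S + ε * C) := by nlinarith
    exact le_of_mul_le_mul_left h3 hε
  have hC0 : 0 ≤ C := Finset.sum_nonneg fun t _ =>
    div_nonneg (sq_nonneg _) (mul_nonneg zero_le_two (e2_nonneg _))
  have hfin : frob M ^ 2 ≤ frob M * S := by
    refine le_of_forall_pos_le_add fun δ hδ => ?_
    refine (key (δ / (C + 1)) (by positivity)).trans ?_
    have : δ / (C + 1) * C ≤ δ := by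
      rw [div_mul_eq_mul_div, div_le_iff₀ (by positivity)]
      nlinarith
    linarith
  rcases hF0.eq_or_lt with h0 | h0
  · rw [← h0]
    exact hS0
  · rw [pow_two] at hfin
    exact le_of_mul_le_mul_left hfin h0
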